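/- Let n ≥ 1 and f : (Fin n → Bool) → (Fin n → Bool). If the iteration graph Γ(f) is strongly connected (for all x, y : Fin n → Bool, y is reachable from x under the reflexive-transitive closure of a ⟶ b ↔ ∃ i : Fin n, b = Function.update a i (f a i)), then the map G_f (S, x) = (fun t => S (t+1), Function.update x (S 0) (f x (S 0))) on X = (ℕ → Fin n) × (Fin n → Bool), with the product topology (Fin n and Bool discrete), is topologically transitive: for all nonempty open sets U, V ⊆ X there exists k : ℕ such that (G_f^[k]) '' U ∩ V ≠ ∅. -/

import Mathlib

/-- One-step relation of the iteration graph Γ(f): an arc from `a` to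
`Function.update a i (f a i)` for each `i`. -/
def IterStep (n : ℕ) (f : (Fin n → Bool) → (Fin n → Bool))
    (a b : Fin n → Bool) : Prop :=
  ∃ i : Fin n, b = Function.update a i (f a i)

/-- The chaotic-iterations map `G_f` on `X = (ℕ → Fin n) × (Fin n → Bool)`. -/
def Gmap (n : ℕ) (f : (Fin n → Bool) → (Fin n → Bool))
    (P : (ℕ → Fin n) × (Fin n → Bool)) : (ℕ → Fin n) × (Fin n → Bool) :=
  (fun t => P.1 (t + 1), Function.update P.2 (P.1 0) (f P.2 (P.1 0)))

/-- The strategy that first plays `i` and then follows `S`. -/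
def consStrategy {n : ℕ} (i : Fin n) (S : ℕ → Fin n) : ℕ → Fin n
  | 0 => i
  | t + 1 => S t

theorem Gmap_consStrategy {n : ℕ} (f : (Fin n → Bool) → (Fin n → Bool)) (i : Fin n)
    (S : ℕ → Fin n) (x : Fin n → Bool) :
    Gmap n f (consStrategy i S, x) = (S, Function.update x i (f x i)) :=
  rfl

theorem exists_iterate_Gmap_eq_of_reflTransGen {n : ℕ} {f : (Fin n → Bool) → (Fin n → Bool)}
    {x y : Fin n → Bool} (h : Relation.ReflTransGen (IterStep n f) x y) (T : ℕ → Fin n) :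
    ∃ (k : ℕ) (S : ℕ → Fin n), (Gmap n f)^[k] (S, x) = (T, y) := by
  induction h using Relation.ReflTransGen.head_induction_on with
  | refl => exact ⟨0, T, rfl⟩
  | head hstep _ ih =>
    obtain ⟨i, rfl⟩ := hstep
    obtain ⟨k, S, hS⟩ := ih
    exact ⟨k + 1, consStrategy i S, by rw [Function.iterate_succ_apply, Gmap_consStrategy, hS]⟩

theorem exists_prefix_iterate_Gmap_eq {n : ℕ} (f : (Fin n → Bool) → (Fin n → Bool)) (m : ℕ)
    (S₀ S' : ℕ → Fin n) (x : Fin n → Bool) :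
    ∃ S : ℕ → Fin n, (∀ t < m, S t = S₀ t) ∧
      (Gmap n f)^[m] (S, x) = (S', ((Gmap n f)^[m] (S₀, x)).2) := by
  induction m generalizing S₀ x with
  | zero => exact ⟨S', by simp, rfl⟩
  | succ m ih =>
    obtain ⟨S, hpre, hS⟩ :=
      ih (fun t => S₀ (t + 1)) (Function.update x (S₀ 0) (f x (S₀ 0)))
    refine ⟨consStrategy (S₀ 0) S, ?_, ?_⟩
    · rintro (_ | t) ht
      · rfl
      · exact hpre t (by omega)
    · rw [Function.iterate_succ_apply, Gmap_consStrategy, hS, Function.iterate_succ_apply]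
      rfl

open Filter Topology in
theorem tendsto_of_forall_lt_eq {α : Type*} [TopologicalSpace α] {s : ℕ → ℕ → α} {a : ℕ → α}
    (h : ∀ m, ∀ t < m, s m t = a t) : Tendsto s atTop (𝓝 a) :=
  tendsto_pi_nhds.2 fun t => tendsto_const_nhds.congr' <|
    (eventually_gt_atTop t).mono fun m hm => (h m t hm).symm

/-- If the iteration graph `Γ(f)` is strongly connected, then `G_f` is
topologically transitive on `(ℕ → Fin n) × (Fin n → Bool)` with the product
topology (`Fin n` and `Bool` discrete). -/
theorem transitive_of_strongly_connected (n : ℕ) (hn : 1 ≤ n)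
    (f : (Fin n → Bool) → (Fin n → Bool))
    (hsc : ∀ x y : Fin n → Bool, Relation.ReflTransGen (IterStep n f) x y) :
    ∀ U V : Set ((ℕ → Fin n) × (Fin n → Bool)),
      IsOpen U → IsOpen V → U.Nonempty → V.Nonempty →
        ∃ k : ℕ, (((Gmap n f)^[k]) '' U ∩ V).Nonempty := by
  rintro U V hU - ⟨⟨S₀, x⟩, hxU⟩ ⟨⟨T, y⟩, hyV⟩
  choose k S' hS' using fun m =>
    exists_iterate_Gmap_eq_of_reflTransGen (hsc ((Gmap n f)^[m] (S₀, x)).2 y) T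
  choose S hpre hS using fun m => exists_prefix_iterate_Gmap_eq f m S₀ (S' m) x
  obtain ⟨m, hm⟩ := (((tendsto_of_forall_lt_eq hpre).prodMk_nhds
    (tendsto_const_nhds (x := x))).eventually_mem (hU.mem_nhds hxU)).exists
  refine ⟨k m + m, (T, y), ⟨(S m, x), hm, ?_⟩, hyV⟩
  rw [Function.iterate_add_apply, hS, hS']
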